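/- Let (W,S) be a finite Coxeter system. For any J ⊆ S and any w ∈ X_J^{-1}, the set {W_K∘z ∈ P^{(W,S)} : W_K∘z ⊆ W_J∘w (inclusion of subsets of W)} equals the set {W_K∘z ∈ P^{(W,S)} : W_∅∘w ≤_B W_K∘z ≤_B W_∅∘(ω_J∘w)}, where ≤_B is the weak Bruhat order on P^{(W,S)}. -/

import Mathlib

namespace PaperWeakBruhat

variable {B W : Type*} [Group W] {M : CoxeterMatrix B}

/-- The weak Bruhat order on `W`: `x ≤_B x'` iff `x' = y * x` with `ℓ(x') = ℓ(y) + ℓ(x)`. -/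
noncomputable def weakLE (cs : CoxeterSystem M W) (x x' : W) : Prop :=
  ∃ y : W, x' = y * x ∧ cs.length x' = cs.length y + cs.length x

/-- The standard parabolic subgroup `W_J` generated by the simple reflections in `J`. -/
def parabolic (cs : CoxeterSystem M W) (J : Set B) : Subgroup W :=
  Subgroup.closure (cs.simple '' J)

/-- The Solomon subset `X_J` of elements having no descent at `J`. -/
noncomputable def solomon (cs : CoxeterSystem M W) (J : Set B) : Set W :=
  {w : W | ∀ s ∈ J, cs.length w < cs.length (w * cs.simple s)}

/-- The right coclass `W_J ∘ w`, as a subset of `W`. -/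
def coclass (cs : CoxeterSystem M W) (J : Set B) (w : W) : Set W :=
  {x : W | ∃ p ∈ parabolic cs J, x = p * w}

/-- The generating relations of the weak Bruhat order on the set `P^{(W,S)}` of right
coclasses of standard parabolic subgroups:
(1) `W_J ∘ w <_B W_{J∪{s}} ∘ w` and (2) `W_{J∪{s}} ∘ w <_B W_J ∘ (α_{J,s}⁻¹ ∘ w)`,
for `J ⊆ S`, `s ∈ S ∖ J` and `w ∈ X_{J∪{s}}⁻¹`, where `α_{J,s} = ξ_{J∪{s}}⁻¹ ∘ ξ_J`.
Here `ξ : Set B → W` is the family of longest elements of the Solomon sets `X_J`. -/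
noncomputable def pRel (cs : CoxeterSystem M W) (ξ : Set B → W) :
    Set W → Set W → Prop := fun A C =>
  ∃ (J : Set B) (s : B) (w : W), s ∉ J ∧ w⁻¹ ∈ solomon cs (J ∪ {s}) ∧
    ((A = coclass cs J w ∧ C = coclass cs (J ∪ {s}) w) ∨
     (A = coclass cs (J ∪ {s}) w ∧
        C = coclass cs J (((ξ (J ∪ {s}))⁻¹ * ξ J)⁻¹ * w)))

section Exchange

open Classical in
/-- The action of a simple reflection on `W × ZMod 2`, conjugating the first component and flipping
the second one exactly over the simple reflection itself. -/
noncomputable def signedConj (cs : CoxeterSystem M W) (i : B) : Function.End (W × ZMod 2) :=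
  fun x => (cs.simple i * x.1 * cs.simple i, x.2 + if x.1 = cs.simple i then 1 else 0)

open Classical in
theorem signedConj_mul_pow (cs : CoxeterSystem M W) (i j : B) (k : ℕ) (x : W × ZMod 2) :
    ((signedConj cs i * signedConj cs j) ^ k) x =
      ((cs.simple i * cs.simple j) ^ k * x.1 * ((cs.simple i * cs.simple j) ^ k)⁻¹,
        x.2 + ∑ l ∈ Finset.range (2 * k),
          if x.1 = cs.simple j * (cs.simple i * cs.simple j) ^ l then 1 else 0) := by
  induction k with
  | zero => simp [Function.End.one_def]
  | succ k ih =>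
    have hconj : ∀ n : ℕ, ((cs.simple i * cs.simple j) ^ n)⁻¹ * cs.simple j =
        cs.simple j * (cs.simple i * cs.simple j) ^ n := by
      intro n
      rw [inv_mul_eq_iff_eq_mul]
      induction n with
      | zero => simp
      | succ n ihn =>
        calc cs.simple j = (cs.simple i * cs.simple j) ^ n *
              (cs.simple j * (cs.simple i * cs.simple j) ^ n) := ihn
          _ = (cs.simple i * cs.simple j) ^ (n + 1) *
              (cs.simple j * (cs.simple i * cs.simple j) ^ (n + 1)) := by
            nth_rewrite 1 [pow_succ]
            rw [pow_succ']
            simp [mul_assoc]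
    have hfst : ∀ (n : ℕ) (a : W),
        ((cs.simple i * cs.simple j) ^ n * x.1 * ((cs.simple i * cs.simple j) ^ n)⁻¹ = a ↔
          x.1 = ((cs.simple i * cs.simple j) ^ n)⁻¹ * a * (cs.simple i * cs.simple j) ^ n) := by
      intro n a
      constructor
      · rintro rfl; group
      · intro h; rw [h]; group
    have h₁ : ((cs.simple i * cs.simple j) ^ k * x.1 * ((cs.simple i * cs.simple j) ^ k)⁻¹ =
        cs.simple j) ↔ x.1 = cs.simple j * (cs.simple i * cs.simple j) ^ (2 * k) := by
      rw [hfst, hconj, two_mul, pow_add, mul_assoc]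
    have h₂ : (cs.simple j * ((cs.simple i * cs.simple j) ^ k * x.1 *
        ((cs.simple i * cs.simple j) ^ k)⁻¹) * cs.simple j = cs.simple i) ↔
        x.1 = cs.simple j * (cs.simple i * cs.simple j) ^ (2 * k + 1) := by
      have : ∀ y : W, cs.simple j * y * cs.simple j = cs.simple i ↔
          y = cs.simple j * (cs.simple i * cs.simple j) := by
        intro y
        constructor
        · intro h; rw [← h]; simp [mul_assoc]
        · rintro rfl; simp [mul_assoc]
      rw [this, hfst, ← mul_assoc, hconj]
      rw [show 2 * k + 1 = k + (1 + k) by ring, pow_add, pow_add, pow_one]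
      simp only [mul_assoc]
    rw [pow_succ']
    change signedConj cs i (signedConj cs j (((signedConj cs i * signedConj cs j) ^ k) x)) = _
    rw [ih]
    simp only [signedConj]
    rw [show 2 * (k + 1) = 2 * k + 1 + 1 by ring, Finset.sum_range_succ, Finset.sum_range_succ]
    simp only [h₁, h₂]
    refine Prod.ext ?_ ?_
    · simp [pow_succ', mul_assoc]
    · simp only [add_assoc]

theorem isLiftable_signedConj (cs : CoxeterSystem M W) : M.IsLiftable (signedConj cs) := by
  classical
  intro i j
  funext x
  rw [signedConj_mul_pow, two_mul, Finset.sum_range_add]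
  simp [pow_add, CharTwo.add_self_eq_zero, Function.End.one_def]

/-- The action of `W` on `W × ZMod 2` extending `signedConj`. -/
noncomputable def signedConjHom (cs : CoxeterSystem M W) : W →* Function.End (W × ZMod 2) :=
  cs.lift ⟨signedConj cs, isLiftable_signedConj cs⟩

theorem signedConjHom_simple (cs : CoxeterSystem M W) (i : B) :
    signedConjHom cs (cs.simple i) = signedConj cs i :=
  cs.lift_apply_simple (isLiftable_signedConj cs) i

open Classical in
theorem signedConjHom_wordProd (cs : CoxeterSystem M W) (ω : List B) (x : W × ZMod 2) :
    signedConjHom cs (cs.wordProd ω) x =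
      (cs.wordProd ω * x.1 * (cs.wordProd ω)⁻¹, x.2 + ((cs.rightInvSeq ω).count x.1 : ZMod 2)) := by
  induction ω with
  | nil => simp [Function.End.one_def]
  | cons i ω ih =>
    rw [cs.wordProd_cons, map_mul, signedConjHom_simple]
    change signedConj cs i (signedConjHom cs (cs.wordProd ω) x) = _
    rw [ih]
    simp only [signedConj, CoxeterSystem.rightInvSeq, List.count_cons]
    refine Prod.ext ?_ ?_
    · simp [mul_assoc]
    · have : (cs.wordProd ω * x.1 * (cs.wordProd ω)⁻¹ = cs.simple i) ↔
          ((cs.wordProd ω)⁻¹ * cs.simple i * cs.wordProd ω = x.1) := by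
        constructor
        · intro h; rw [← h]; group
        · intro h; rw [← h]; group
      simp only [this, beq_iff_eq]
      push_cast
      rw [add_assoc]

theorem simple_mem_rightInvSeq (cs : CoxeterSystem M W) (ω : List B) (i : B)
    (h : cs.IsRightDescent (cs.wordProd ω) i) : cs.simple i ∈ cs.rightInvSeq ω := by
  classical
  by_contra hmem
  obtain ⟨ω', hω', hprod⟩ := cs.exists_isReduced (cs.wordProd ω * cs.simple i)
  have hact : signedConjHom cs (cs.wordProd ω * cs.simple i) (cs.simple i, 0) =
      signedConjHom cs (cs.wordProd ω) (cs.simple i, 1) := by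
    rw [map_mul, signedConjHom_simple]
    change signedConjHom cs (cs.wordProd ω) (signedConj cs i (cs.simple i, 0)) = _
    simp [signedConj]
  rw [hprod, signedConjHom_wordProd, signedConjHom_wordProd] at hact
  have hcount := congrArg Prod.snd hact
  simp only [List.count_eq_zero_of_not_mem hmem, Nat.cast_zero, add_zero, zero_add] at hcount
  have hmem' : cs.simple i ∈ cs.rightInvSeq ω' := by
    by_contra hn
    rw [List.count_eq_zero_of_not_mem hn] at hcount
    exact absurd hcount (by simp)
  have hlt := (cs.isRightInversion_of_mem_rightInvSeq hω' hmem').2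
  rw [← hprod, mul_assoc, cs.simple_mul_simple_self, mul_one] at hlt
  exact lt_asymm hlt h

/-- The exchange condition. -/
theorem exists_eraseIdx_of_isLeftDescent (cs : CoxeterSystem M W) (ω : List B) (i : B)
    (h : cs.IsLeftDescent (cs.wordProd ω) i) :
    ∃ k < ω.length, cs.simple i * cs.wordProd ω = cs.wordProd (ω.eraseIdx k) := by
  have hmem : cs.simple i ∈ cs.leftInvSeq ω := by
    have := simple_mem_rightInvSeq cs ω.reverse i
      (by rwa [cs.wordProd_reverse, cs.isRightDescent_inv_iff])
    rwa [cs.rightInvSeq_reverse, List.mem_reverse] at this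
  obtain ⟨k, hk, hki⟩ := List.getElem_of_mem hmem
  refine ⟨k, by simpa using hk, ?_⟩
  rw [← cs.getD_leftInvSeq_mul_wordProd, List.getD_eq_getElem _ _ hk, hki]

/-- If a simple reflection lengthens `a` but shortens the reduced product `a * b`, the exchange
takes place in `b`. -/
theorem exists_mul_eq_of_isLeftDescent_mul (cs : CoxeterSystem M W) {a b : W} {i : B}
    (hab : cs.length (a * b) = cs.length a + cs.length b)
    (ha : ¬ cs.IsLeftDescent a i) (h : cs.IsLeftDescent (a * b) i) :
    ∃ b', cs.simple i * (a * b) = a * b' ∧ cs.length b' < cs.length b := by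
  obtain ⟨u, hu, rfl⟩ := cs.exists_isReduced a
  obtain ⟨v, hv, rfl⟩ := cs.exists_isReduced b
  rw [← cs.wordProd_append] at h
  obtain ⟨k, hk, hki⟩ := exists_eraseIdx_of_isLeftDescent cs _ _ h
  rw [← cs.wordProd_append, hki]
  rw [List.length_append] at hk
  rcases lt_or_ge k u.length with hku | hku
  · exfalso
    rw [List.eraseIdx_append_of_lt_length hku, cs.wordProd_append, cs.wordProd_append,
      ← mul_assoc, mul_left_inj] at hki
    apply ha
    have := cs.length_wordProd_le (u.eraseIdx k)
    rw [← hki, List.length_eraseIdx_of_lt hku] at this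
    unfold CoxeterSystem.IsLeftDescent
    rw [hu.eq]
    omega
  · rw [List.eraseIdx_append_of_length_le hku]
    refine ⟨cs.wordProd (v.eraseIdx (k - u.length)), cs.wordProd_append _ _, ?_⟩
    have := cs.length_wordProd_le (v.eraseIdx (k - u.length))
    rw [List.length_eraseIdx_of_lt (by omega)] at this
    rw [hv.eq]
    omega

end Exchange

section Parabolic

theorem simple_mem_parabolic (cs : CoxeterSystem M W) {J : Set B} {i : B} (hi : i ∈ J) :
    cs.simple i ∈ parabolic cs J :=
  Subgroup.subset_closure ⟨i, hi, rfl⟩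

theorem parabolic_mono (cs : CoxeterSystem M W) {J K : Set B} (h : J ⊆ K) :
    parabolic cs J ≤ parabolic cs K :=
  Subgroup.closure_mono (Set.image_mono h)

theorem parabolic_empty (cs : CoxeterSystem M W) : parabolic cs ∅ = ⊥ := by
  simp [parabolic]

theorem wordProd_mem_parabolic (cs : CoxeterSystem M W) {J : Set B} {ω : List B}
    (h : ∀ i ∈ ω, i ∈ J) : cs.wordProd ω ∈ parabolic cs J := by
  induction ω with
  | nil => simp [one_mem]
  | cons i ω ih =>
    rw [cs.wordProd_cons]
    exact mul_mem (simple_mem_parabolic cs (h i (by simp)))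
      (ih fun j hj => h j (List.mem_cons_of_mem _ hj))

/-- Elements of a standard parabolic subgroup have reduced words in the given generators. -/
theorem exists_isReduced_of_mem_parabolic (cs : CoxeterSystem M W) {J : Set B} {p : W}
    (hp : p ∈ parabolic cs J) :
    ∃ ω : List B, (∀ i ∈ ω, i ∈ J) ∧ cs.IsReduced ω ∧ cs.wordProd ω = p := by
  have step : ∀ i ∈ J, ∀ q : W,
      (∃ ω : List B, (∀ i ∈ ω, i ∈ J) ∧ cs.IsReduced ω ∧ cs.wordProd ω = q) →
      ∃ ω : List B, (∀ i ∈ ω, i ∈ J) ∧ cs.IsReduced ω ∧ cs.wordProd ω = cs.simple i * q := by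
    rintro i hi q ⟨ω, hωJ, hω, rfl⟩
    by_cases hd : cs.IsLeftDescent (cs.wordProd ω) i
    · obtain ⟨k, hk, hki⟩ := exists_eraseIdx_of_isLeftDescent cs ω i hd
      refine ⟨ω.eraseIdx k, fun j hj => hωJ j (List.mem_of_mem_eraseIdx hj), ?_, hki.symm⟩
      rw [cs.isLeftDescent_iff, hω.eq, hki] at hd
      unfold CoxeterSystem.IsReduced
      rw [List.length_eraseIdx_of_lt hk]
      omega
    · refine ⟨i :: ω, by simpa [hi] using hωJ, ?_, cs.wordProd_cons i ω⟩
      rw [cs.not_isLeftDescent_iff, hω.eq] at hd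
      unfold CoxeterSystem.IsReduced
      rw [cs.wordProd_cons, hd, List.length_cons]
  induction hp using Subgroup.closure_induction_left with
  | one => exact ⟨[], by simp, by simp [CoxeterSystem.IsReduced], by simp⟩
  | mul_left x hx y _ ih =>
    obtain ⟨i, hi, rfl⟩ := hx
    exact step i hi y ih
  | inv_mul_cancel x hx y _ ih =>
    obtain ⟨i, hi, rfl⟩ := hx
    rw [cs.inv_simple]
    exact step i hi y ih

/-- Induction on an element of a standard parabolic subgroup along a reduced word. -/
theorem parabolic_induction (cs : CoxeterSystem M W) {J : Set B} 
    {P : (p : W) → p ∈ parabolic cs J → Prop} (one : P 1 (one_mem _))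
    (simple_mul : ∀ (i : B) (hi : i ∈ J) (p : W) (hp : p ∈ parabolic cs J),
      ¬ cs.IsLeftDescent p i → P p hp →
        P (cs.simple i * p) (mul_mem (simple_mem_parabolic cs hi) hp))
    {p : W} (hp : p ∈ parabolic cs J) : P p hp := by
  obtain ⟨ω, hωJ, hω, rfl⟩ := exists_isReduced_of_mem_parabolic cs hp
  induction ω with
  | nil => exact one
  | cons i ω ih =>
    have hred : cs.IsReduced ω := by simpa using hω.drop 1
    have hJ : ∀ j ∈ ω, j ∈ J := fun j hj => hωJ j (List.mem_cons_of_mem _ hj)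
    revert hp
    rw [cs.wordProd_cons]
    intro hp
    refine simple_mul i (hωJ i (by simp)) _ (wordProd_mem_parabolic cs hJ) ?_ (ih hJ hred _)
    have := hω.eq
    rw [cs.wordProd_cons] at this
    rw [cs.not_isLeftDescent_iff, this, hred.eq, List.length_cons]

theorem exists_isLeftDescent_of_mem_parabolic (cs : CoxeterSystem M W) {J : Set B} {p : W}
    (hp : p ∈ parabolic cs J) (hne : p ≠ 1) : ∃ i ∈ J, cs.IsLeftDescent p i := by
  revert hne
  induction hp using parabolic_induction with
  | one => exact fun h => absurd rfl h
  | simple_mul i hi p _ hd _ =>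
    intro _
    refine ⟨i, hi, ?_⟩
    rw [cs.isLeftDescent_iff_not_isLeftDescent_mul]
    simpa using hd

theorem simple_mul_mem_parabolic_of_isLeftDescent (cs : CoxeterSystem M W) {J : Set B} {p : W}
    (hp : p ∈ parabolic cs J) {i : B} (h : cs.IsLeftDescent p i) :
    cs.simple i * p ∈ parabolic cs J := by
  obtain ⟨ω, hωJ, -, rfl⟩ := exists_isReduced_of_mem_parabolic cs hp
  obtain ⟨k, -, hki⟩ := exists_eraseIdx_of_isLeftDescent cs ω i h
  rw [hki]
  exact wordProd_mem_parabolic cs fun j hj => hωJ j (List.mem_of_mem_eraseIdx hj)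

/-- Standard parabolic subgroups are closed under suffixes of reduced products. -/
theorem mem_parabolic_of_length_mul (cs : CoxeterSystem M W) {J : Set B} {x y : W}
    (hxy : x * y ∈ parabolic cs J) (h : cs.length (x * y) = cs.length x + cs.length y) :
    y ∈ parabolic cs J := by
  obtain ⟨ω, hω, rfl⟩ := cs.exists_isReduced x
  induction ω with
  | nil => simpa using hxy
  | cons i ω ih =>
    have hred : cs.IsReduced ω := by simpa using hω.drop 1
    have hlen : cs.length (cs.wordProd ω * y) = cs.length (cs.wordProd ω) + cs.length y ∧
        cs.IsLeftDescent (cs.wordProd (i :: ω) * y) i := by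
      have h₁ := cs.length_mul_le (cs.wordProd ω) y
      have h₂ := cs.length_simple_mul (cs.wordProd ω * y) i
      have h₃ := hω.eq
      have h₄ := hred.eq
      rw [CoxeterSystem.IsLeftDescent]
      rw [cs.wordProd_cons, List.length_cons] at *
      simp only [mul_assoc, CoxeterSystem.simple_mul_simple_cancel_left] at *
      omega
    refine ih hred ?_ hlen.1
    have := simple_mul_mem_parabolic_of_isLeftDescent cs hxy hlen.2
    simpa [cs.wordProd_cons, mul_assoc] using this

end Parabolic

section Coset

theorem inv_mem_solomon_iff (cs : CoxeterSystem M W) {J : Set B} {w : W} :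
    w⁻¹ ∈ solomon cs J ↔ ∀ i ∈ J, ¬ cs.IsLeftDescent w i := by
  unfold solomon
  refine forall₂_congr fun i _ => ?_
  rw [← cs.isRightDescent_inv_iff, CoxeterSystem.IsRightDescent, not_lt]
  exact ⟨le_of_lt, fun h => h.lt_of_ne (cs.length_mul_simple_ne _ _).symm⟩

theorem solomon_anti (cs : CoxeterSystem M W) {J K : Set B} (h : J ⊆ K) :
    solomon cs K ⊆ solomon cs J :=
  fun _ hw i hi => hw i (h hi)

theorem length_mul_of_minimal (cs : CoxeterSystem M W) {J : Set B} {w : W}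
    (hw : ∀ q ∈ parabolic cs J, cs.length w ≤ cs.length (q * w)) {p : W}
    (hp : p ∈ parabolic cs J) : cs.length (p * w) = cs.length p + cs.length w := by
  induction hp using parabolic_induction with
  | one => simp
  | simple_mul i hi p hp hd ih =>
    have h₁ : ¬ cs.IsLeftDescent (p * w) i := by
      intro h
      obtain ⟨b, hb, hlt⟩ := exists_mul_eq_of_isLeftDescent_mul cs ih hd h
      have hb' : b = (p⁻¹ * cs.simple i * p) * w := by
        rw [← mul_right_inj p, ← hb]; group
      have := hw _ (mul_mem (mul_mem (inv_mem hp) (simple_mem_parabolic cs hi)) hp)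
      rw [← hb'] at this
      omega
    rw [cs.not_isLeftDescent_iff] at h₁ hd
    rw [mul_assoc, h₁, ih, hd]
    omega

/-- Lengths add up along `W_J × X_J⁻¹`. -/
theorem length_mul_of_inv_mem_solomon (cs : CoxeterSystem M W) {J : Set B} {w : W}
    (hw : w⁻¹ ∈ solomon cs J) {p : W} (hp : p ∈ parabolic cs J) :
    cs.length (p * w) = cs.length p + cs.length w := by
  refine length_mul_of_minimal cs ?_ hp
  obtain ⟨q, hq, hmin⟩ := (measure fun q => cs.length (q * w)).wf.has_min
    (parabolic cs J : Set W) ⟨1, one_mem _⟩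
  have hmin' : ∀ r ∈ parabolic cs J, cs.length (q * w) ≤ cs.length (r * (q * w)) := by
    intro r hr
    rw [← mul_assoc]
    exact not_lt.mp (hmin (r * q) (mul_mem hr hq))
  have hq1 : q⁻¹ = 1 := by
    by_contra hne
    obtain ⟨i, hi, hd⟩ := exists_isLeftDescent_of_mem_parabolic cs (inv_mem hq) hne
    refine (inv_mem_solomon_iff cs).mp hw i hi ?_
    have h₁ := length_mul_of_minimal cs hmin' (inv_mem hq)
    have h₂ := length_mul_of_minimal cs hmin'
      (mul_mem (simple_mem_parabolic cs hi) (inv_mem hq))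
    simp only [mul_assoc, inv_mul_cancel_left] at h₁ h₂
    unfold CoxeterSystem.IsLeftDescent at hd ⊢
    omega
  rw [inv_eq_one] at hq1
  simpa [hq1] using hmin'

theorem weakLE_of_inv_mem_solomon (cs : CoxeterSystem M W) {J : Set B} {w : W}
    (hw : w⁻¹ ∈ solomon cs J) {p : W} (hp : p ∈ parabolic cs J) : weakLE cs w (p * w) :=
  ⟨p, rfl, length_mul_of_inv_mem_solomon cs hw hp⟩

theorem weakLE_trans (cs : CoxeterSystem M W) {x y z : W} (hxy : weakLE cs x y)
    (hyz : weakLE cs y z) : weakLE cs x z := by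
  obtain ⟨a, rfl, ha⟩ := hxy
  obtain ⟨b, rfl, hb⟩ := hyz
  refine ⟨b * a, (mul_assoc b a x).symm, ?_⟩
  have h₁ := cs.length_mul_le (b * a) x
  have h₂ := cs.length_mul_le b a
  rw [mul_assoc] at h₁
  omega

/-- If all elements of `J` are left descents of `u`, every element of `W_J` is a prefix of `u`. -/
theorem length_eq_of_forall_isLeftDescent (cs : CoxeterSystem M W) {J : Set B} {u : W}
    (hu : ∀ i ∈ J, cs.IsLeftDescent u i) {p : W} (hp : p ∈ parabolic cs J) :
    cs.length u = cs.length p + cs.length (p⁻¹ * u) := by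
  induction hp using parabolic_induction with
  | one => simp
  | simple_mul i hi p hp hd ih =>
    obtain ⟨b, hb, hlt⟩ := exists_mul_eq_of_isLeftDescent_mul cs (a := p) (b := p⁻¹ * u)
      (by rw [mul_inv_cancel_left, ih]) hd (by rw [mul_inv_cancel_left]; exact hu i hi)
    have hb' : (cs.simple i * p)⁻¹ * u = b := by
      rw [mul_inv_cancel_left] at hb
      rw [mul_inv_rev, cs.inv_simple, mul_assoc, hb, inv_mul_cancel_left]
    have h₁ := cs.length_mul_le (cs.simple i * p) b
    rw [← hb', mul_inv_cancel_left, hb'] at h₁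
    rw [cs.not_isLeftDescent_iff] at hd
    rw [hb']
    omega

end Coset

section Longest

variable {cs : CoxeterSystem M W} {J : Set B} {u : W}

theorem isLeftDescent_of_longest (hu : u ∈ parabolic cs J)
    (hmax : ∀ x ∈ parabolic cs J, cs.length x ≤ cs.length u) {i : B} (hi : i ∈ J) :
    cs.IsLeftDescent u i :=
  (hmax _ (mul_mem (simple_mem_parabolic cs hi) hu)).lt_of_ne (cs.length_simple_mul_ne u i)

theorem inv_eq_self_of_longest (hu : u ∈ parabolic cs J)
    (hmax : ∀ x ∈ parabolic cs J, cs.length x ≤ cs.length u) : u⁻¹ = u := by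
  have h := length_eq_of_forall_isLeftDescent cs
    (fun i hi => isLeftDescent_of_longest hu hmax hi) (inv_mem hu)
  rw [cs.length_inv, inv_inv] at h
  have : u * u = 1 := cs.length_eq_zero_iff.mp (by omega)
  exact inv_eq_of_mul_eq_one_left this

theorem length_mul_longest (hu : u ∈ parabolic cs J)
    (hmax : ∀ x ∈ parabolic cs J, cs.length x ≤ cs.length u) {p : W}
    (hp : p ∈ parabolic cs J) : cs.length u = cs.length p + cs.length (p * u) := by
  simpa using length_eq_of_forall_isLeftDescent cs
    (fun i hi => isLeftDescent_of_longest hu hmax hi) (inv_mem hp)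

theorem weakLE_longest_mul (hu : u ∈ parabolic cs J)
    (hmax : ∀ x ∈ parabolic cs J, cs.length x ≤ cs.length u) {w : W} (hw : w⁻¹ ∈ solomon cs J)
    {p : W} (hp : p ∈ parabolic cs J) : weakLE cs (p * w) (u * w) := by
  refine ⟨u * p⁻¹, by group, ?_⟩
  rw [length_mul_of_inv_mem_solomon cs hw hu, length_mul_of_inv_mem_solomon cs hw hp,
    length_mul_longest hu hmax hp, ← cs.length_inv (u * p⁻¹), mul_inv_rev, inv_inv,
    inv_eq_self_of_longest hu hmax]
  omega

theorem longest_singleton {i : B} (hu : u ∈ parabolic cs {i})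
    (hmax : ∀ x ∈ parabolic cs {i}, cs.length x ≤ cs.length u) : u = cs.simple i := by
  have h₁ : u ≠ 1 := by
    rintro rfl
    have := hmax _ (simple_mem_parabolic cs (Set.mem_singleton i))
    simp at this
  have : ∀ p ∈ parabolic cs {i}, p = 1 ∨ p = cs.simple i := by
    intro p hp
    induction hp using parabolic_induction with
    | one => exact Or.inl rfl
    | simple_mul j hj p _ _ ih =>
      obtain rfl : j = i := hj
      rcases ih with rfl | rfl <;> simp
  exact (this u hu).resolve_left h₁

end Longest

section Order

variable {cs : CoxeterSystem M W} {ωf ξ : Set B → W}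

theorem coclass_empty (cs : CoxeterSystem M W) (x : W) : coclass cs ∅ x = {x} := by
  ext y
  simp [coclass, parabolic_empty]

theorem mem_coclass_self (cs : CoxeterSystem M W) (J : Set B) (x : W) : x ∈ coclass cs J x :=
  ⟨1, one_mem _, (one_mul x).symm⟩

theorem inv_alpha_eq {ωS : W} (hξ : ∀ J : Set B, ξ J ∈ solomon cs J ∧ ωS = ξ J * ωf J)
    (J K : Set B) : ((ξ K)⁻¹ * ξ J)⁻¹ = ωf J * (ωf K)⁻¹ := by
  have h := (hξ J).2.symm.trans (hξ K).2
  rw [mul_inv_rev, inv_inv, inv_mul_eq_iff_eq_mul, ← mul_assoc, h, mul_inv_cancel_right]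

theorem pRel_weakLE {ωS : W}
    (hω : ∀ J : Set B, ωf J ∈ parabolic cs J ∧
      ∀ x ∈ parabolic cs J, cs.length x ≤ cs.length (ωf J))
    (hξ : ∀ J : Set B, ξ J ∈ solomon cs J ∧ ωS = ξ J * ωf J)
    {A C : Set W} (h : pRel cs ξ A C) :
    (∀ c ∈ C, ∃ a ∈ A, weakLE cs a c) ∧ (∀ a ∈ A, ∃ c ∈ C, weakLE cs a c) := by
  obtain ⟨J, s, w, -, hw, ⟨rfl, rfl⟩ | ⟨rfl, rfl⟩⟩ := h
  · refine ⟨?_, ?_⟩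
    · rintro _ ⟨p, hp, rfl⟩
      exact ⟨w, mem_coclass_self cs J w, weakLE_of_inv_mem_solomon cs hw hp⟩
    · rintro _ ⟨p, hp, rfl⟩
      exact ⟨p * w, ⟨p, parabolic_mono cs Set.subset_union_left hp, rfl⟩, 1, by simp, by simp⟩
  · rw [inv_alpha_eq hξ]
    refine ⟨?_, ?_⟩
    · rintro _ ⟨p, hp, rfl⟩
      refine ⟨w, mem_coclass_self cs _ w, ?_⟩
      have hle := parabolic_mono cs (Set.subset_union_left : J ⊆ J ∪ {s})
      rw [← mul_assoc]
      exact weakLE_of_inv_mem_solomon cs hw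
        (mul_mem (hle hp) (mul_mem (hle (hω J).1) (inv_mem (hω _).1)))
    · rintro _ ⟨p, hp, rfl⟩
      refine ⟨ωf (J ∪ {s}) * w, ⟨(ωf J)⁻¹, inv_mem (hω J).1, ?_⟩,
        weakLE_longest_mul (hω _).1 (hω _).2 hw hp⟩
      rw [inv_eq_self_of_longest (hω (J ∪ {s})).1 (hω _).2]
      group

theorem reflTransGen_pRel_weakLE {ωS : W}
    (hω : ∀ J : Set B, ωf J ∈ parabolic cs J ∧
      ∀ x ∈ parabolic cs J, cs.length x ≤ cs.length (ωf J))
    (hξ : ∀ J : Set B, ξ J ∈ solomon cs J ∧ ωS = ξ J * ωf J)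
    {A C : Set W} (h : Relation.ReflTransGen (pRel cs ξ) A C) :
    (∀ c ∈ C, ∃ a ∈ A, weakLE cs a c) ∧ (∀ a ∈ A, ∃ c ∈ C, weakLE cs a c) := by
  induction h with
  | refl =>
    exact ⟨fun x hx => ⟨x, hx, 1, by simp, by simp⟩,
      fun x hx => ⟨x, hx, 1, by simp, by simp⟩⟩
  | tail _ h ih =>
    have h' := pRel_weakLE hω hξ h
    refine ⟨fun c hc => ?_, fun a ha => ?_⟩
    · obtain ⟨b, hb, hbc⟩ := h'.1 c hc
      obtain ⟨a, ha, hab⟩ := ih.1 b hb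
      exact ⟨a, ha, weakLE_trans cs hab hbc⟩
    · obtain ⟨b, hb, hab⟩ := ih.2 a ha
      obtain ⟨c, hc, hbc⟩ := h'.2 b hb
      exact ⟨c, hc, weakLE_trans cs hab hbc⟩

theorem reflTransGen_coclass_empty_simple_mul {ωS : W}
    (hω : ∀ J : Set B, ωf J ∈ parabolic cs J ∧
      ∀ x ∈ parabolic cs J, cs.length x ≤ cs.length (ωf J))
    (hξ : ∀ J : Set B, ξ J ∈ solomon cs J ∧ ωS = ξ J * ωf J)
    {x : W} {i : B} (h : ¬ cs.IsLeftDescent x i) :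
    Relation.ReflTransGen (pRel cs ξ) (coclass cs ∅ x) (coclass cs ∅ (cs.simple i * x)) := by
  have hx : x⁻¹ ∈ solomon cs (∅ ∪ {i}) := by
    rw [inv_mem_solomon_iff]
    simpa using h
  have hsingle : ωf (∅ ∪ {i}) = cs.simple i := by
    rw [Set.empty_union]
    exact longest_singleton (hω {i}).1 (hω {i}).2
  have hempty : ωf ∅ = 1 := by
    simpa [parabolic_empty] using (hω ∅).1
  refine (Relation.ReflTransGen.single (b := coclass cs (∅ ∪ {i}) x)
    ⟨∅, i, x, by simp, hx, Or.inl ⟨rfl, rfl⟩⟩).tail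
      ⟨∅, i, x, by simp, hx, Or.inr ⟨rfl, ?_⟩⟩
  rw [inv_alpha_eq hξ, hsingle, hempty, one_mul, cs.inv_simple]

theorem reflTransGen_coclass_empty_of_weakLE {ωS : W}
    (hω : ∀ J : Set B, ωf J ∈ parabolic cs J ∧
      ∀ x ∈ parabolic cs J, cs.length x ≤ cs.length (ωf J))
    (hξ : ∀ J : Set B, ξ J ∈ solomon cs J ∧ ωS = ξ J * ωf J)
    {x x' : W} (h : weakLE cs x x') :
    Relation.ReflTransGen (pRel cs ξ) (coclass cs ∅ x) (coclass cs ∅ x') := by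
  obtain ⟨y, rfl, h⟩ := h
  obtain ⟨ω, hred, rfl⟩ := cs.exists_isReduced y
  induction ω with
  | nil => simpa using .refl
  | cons i ω ih =>
    have hred' : cs.IsReduced ω := by simpa using hred.drop 1
    have h₁ := cs.length_mul_le (cs.wordProd ω) x
    have h₂ := cs.length_simple_mul (cs.wordProd ω * x) i
    have h₃ := hred.eq
    have h₄ := hred'.eq
    rw [cs.wordProd_cons] at h h₃ ⊢
    rw [List.length_cons] at h₃
    rw [mul_assoc] at h ⊢
    refine (ih hred' (by omega)).trans (reflTransGen_coclass_empty_simple_mul hω hξ ?_)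
    rw [cs.not_isLeftDescent_iff]
    omega

theorem reflTransGen_coclass_of_finite {K : Set B} (hK : K.Finite) {z : W}
    (hz : z⁻¹ ∈ solomon cs K) :
    Relation.ReflTransGen (pRel cs ξ) (coclass cs ∅ z) (coclass cs K z) := by
  induction K, hK using Set.Finite.induction_on with
  | empty => exact .refl
  | @insert s K hs _ ih =>
    rw [← Set.union_singleton] at hz ⊢
    exact (ih (solomon_anti cs Set.subset_union_left hz)).tail
      ⟨K, s, z, hs, hz, Or.inl ⟨rfl, rfl⟩⟩

theorem reflTransGen_coclass_longest_of_finite {ωS : W}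
    (hω : ∀ J : Set B, ωf J ∈ parabolic cs J ∧
      ∀ x ∈ parabolic cs J, cs.length x ≤ cs.length (ωf J))
    (hξ : ∀ J : Set B, ξ J ∈ solomon cs J ∧ ωS = ξ J * ωf J)
    {K : Set B} (hK : K.Finite) {z : W} (hz : z⁻¹ ∈ solomon cs K) :
    Relation.ReflTransGen (pRel cs ξ) (coclass cs K z) (coclass cs ∅ (ωf K * z)) := by
  induction K, hK using Set.Finite.induction_on generalizing z with
  | empty =>
    have hempty : ωf ∅ = 1 := by simpa [parabolic_empty] using (hω ∅).1
    rw [hempty, one_mul]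
  | @insert s K hs _ ih =>
    rw [← Set.union_singleton] at hz ⊢
    have hle := parabolic_mono cs (Set.subset_union_left : K ⊆ K ∪ {s})
    obtain ⟨hmem, hmax⟩ := hω (K ∪ {s})
    have hz' : (ωf K * ωf (K ∪ {s}) * z)⁻¹ ∈ solomon cs K := by
      rw [inv_mem_solomon_iff]
      intro i hi hd
      have hiK := mul_mem (simple_mem_parabolic cs hi) (hω K).1
      have hlt := isLeftDescent_of_longest (hω K).1 (hω K).2 hi
      have h₁ := length_mul_longest hmem hmax (hle (hω K).1)
      have h₂ := length_mul_longest hmem hmax (hle hiK)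
      have h₃ := length_mul_of_inv_mem_solomon cs hz (mul_mem (hle (hω K).1) hmem)
      have h₄ := length_mul_of_inv_mem_solomon cs hz (mul_mem (hle hiK) hmem)
      unfold CoxeterSystem.IsLeftDescent at hd hlt
      simp only [mul_assoc] at *
      omega
    have hstep : pRel cs ξ (coclass cs (K ∪ {s}) z)
        (coclass cs K (ωf K * ωf (K ∪ {s}) * z)) := by
      refine ⟨K, s, z, hs, hz, Or.inr ⟨rfl, ?_⟩⟩
      rw [inv_alpha_eq hξ, inv_eq_self_of_longest hmem hmax]
    have hcancel : ωf K * (ωf K * ωf (K ∪ {s}) * z) = ωf (K ∪ {s}) * z := by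
      nth_rewrite 1 [← inv_eq_self_of_longest (hω K).1 (hω K).2]
      group
    rw [← hcancel]
    exact (ih hz').head hstep

/-- In a finite Coxeter group, a standard parabolic subgroup is generated by finitely many of the
given generators. -/
theorem exists_finite_parabolic_eq [Finite W] (cs : CoxeterSystem M W) (K : Set B) :
    ∃ K' ⊆ K, K'.Finite ∧ parabolic cs K' = parabolic cs K := by
  obtain ⟨K', hK', hbij⟩ := (Set.surjOn_image cs.simple K).exists_bijOn_subset
  refine ⟨K', hK', Set.Finite.of_finite_image (Set.toFinite _) hbij.injOn, ?_⟩
  rw [parabolic, hbij.image_eq, parabolic]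

end Order

/-- for `J ⊆ S` and `w ∈ X_J⁻¹`, the coclasses contained in `W_J ∘ w` are exactly
the coclasses lying in the weak Bruhat interval `[W_∅ ∘ w, W_∅ ∘ (ω_J ∘ w)]` of `P^{(W,S)}`. -/
theorem inclusion_eq_weak_interval [Finite W] (cs : CoxeterSystem M W)
    (ωS : W) (ωf ξ : Set B → W)
    (hS : ∀ w : W, cs.length w ≤ cs.length ωS)
    (hω : ∀ J : Set B, ωf J ∈ parabolic cs J ∧
      ∀ x ∈ parabolic cs J, cs.length x ≤ cs.length (ωf J))
    (hξ : ∀ J : Set B, ξ J ∈ solomon cs J ∧ ωS = ξ J * ωf J)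
    (J : Set B) (w : W) (hw : w⁻¹ ∈ solomon cs J) :
    {A : Set W | (∃ (K : Set B) (z : W), z⁻¹ ∈ solomon cs K ∧ A = coclass cs K z) ∧
        A ⊆ coclass cs J w} =
    {A : Set W | (∃ (K : Set B) (z : W), z⁻¹ ∈ solomon cs K ∧ A = coclass cs K z) ∧
        Relation.ReflTransGen (pRel cs ξ) (coclass cs ∅ w) A ∧
        Relation.ReflTransGen (pRel cs ξ) A (coclass cs ∅ (ωf J * w))} := by
  ext A
  simp only [Set.mem_ofPred_eq]
  refine and_congr_right ?_
  rintro ⟨K, z, hz, rfl⟩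
  constructor
  · intro hsub
    obtain ⟨u, hu, rfl⟩ := hsub (mem_coclass_self cs K z)
    obtain ⟨K', hK'K, hfin, hpar⟩ := exists_finite_parabolic_eq cs K
    have hcoclass : coclass cs K (u * w) = coclass cs K' (u * w) := by
      rw [coclass, coclass, hpar]
    have hz' := solomon_anti cs hK'K hz
    rw [hcoclass] at hsub ⊢
    obtain ⟨q, hq, hqw⟩ := hsub ⟨ωf K', (hω K').1, rfl⟩
    refine ⟨?_, ?_⟩
    · exact (reflTransGen_coclass_empty_of_weakLE hω hξ
        (weakLE_of_inv_mem_solomon cs hw hu)).trans (reflTransGen_coclass_of_finite hfin hz')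
    · refine (reflTransGen_coclass_longest_of_finite hω hξ hfin hz').trans ?_
      rw [hqw]
      exact reflTransGen_coclass_empty_of_weakLE hω hξ
        (weakLE_longest_mul (hω J).1 (hω J).2 hw hq)
  · rintro ⟨hlow, hhigh⟩ x hx
    obtain ⟨_, hmem, y, rfl, hy⟩ := (reflTransGen_pRel_weakLE hω hξ hlow).1 x hx
    rw [coclass_empty, Set.mem_singleton_iff] at hmem
    subst hmem
    obtain ⟨_, hmem, v, rfl, hv⟩ := (reflTransGen_pRel_weakLE hω hξ hhigh).2 _ hx
    rw [coclass_empty, Set.mem_singleton_iff, ← mul_assoc, mul_left_inj] at hmem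
    have hlen := length_mul_of_inv_mem_solomon cs hw (hω J).1
    rw [← hmem, mul_assoc] at hlen
    have := cs.length_mul_le v y
    exact ⟨y, mem_parabolic_of_length_mul cs (hmem ▸ (hω J).1) (by omega), rfl⟩

end PaperWeakBruhat
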